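/- Let r_0, r_1, r_2, r_3 ∈ M_2(ℂ) satisfy the right orthonormality ρ_1(r_j r_k*) = δ_{jk}, and let h^{(ν)} be the corresponding Haar systems. Then: (i) for every 0 ≤ m ≤ 3 and complex scalars, ‖Σ_{j=0}^{m} α_j r_j‖_♭ ≤ (Σ_{j=0}^{3} ‖r_j‖·‖r_j‖_♭) · ‖Σ_{j=0}^{3} α_j r_j‖_♭; and (ii) if c ≥ 0 is such that ‖Σ_{j=0}^{m} α_j h^{(ν)}_j‖_♭ ≤ c·‖Σ_{j=0}^{4^ν−1} α_j h^{(ν)}_j‖_♭ for all 0 ≤ m < 4^ν and all scalars, then ‖Σ_{j=0}^{m} α_j h^{(ν+1)}_j‖_♭ ≤ max{ c·‖r_0‖², ‖r_0‖² + 2(‖r_1‖² + ‖r_2‖² + ‖r_3‖²) } · ‖Σ_{j=0}^{4^{ν+1}−1} α_j h^{(ν+1)}_j‖_♭ for all 0 ≤ m < 4^{ν+1} and all scalars. (Right Haar system basis constant estimates.) -/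

import Mathlib

open Finset
open scoped ENNReal ComplexOrder Kronecker Matrix

noncomputable section

/-- Kronecker product of square complex matrices, realized on `Fin (m * n)`. -/
def kron {m n : ℕ} (x : Matrix (Fin m) (Fin m) ℂ) (y : Matrix (Fin n) (Fin n) ℂ) :
    Matrix (Fin (m * n)) (Fin (m * n)) ℂ :=
  Matrix.reindex finProdFinEquiv finProdFinEquiv (x ⊗ₖ y)

/-- The matrix `A₁ = diag(α, 1 - α)`. -/
def A1 (α : ℝ) : Matrix (Fin 2) (Fin 2) ℂ :=
  Matrix.diagonal ![(α : ℂ), ((1 - α : ℝ) : ℂ)]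

/-- The matrix `A₁^t = diag(α^t, (1 - α)^t)` (entrywise real power on the diagonal). -/
def A1t (α t : ℝ) : Matrix (Fin 2) (Fin 2) ℂ :=
  Matrix.diagonal ![((α ^ t : ℝ) : ℂ), (((1 - α) ^ t : ℝ) : ℂ)]

/-- `Amat α ν = A_ν`, the ν-fold Kronecker power of `diag(α, 1-α)`. -/
def Amat (α : ℝ) : (ν : ℕ) → Matrix (Fin (2 ^ ν)) (Fin (2 ^ ν)) ℂ
  | 0 => 1
  | ν + 1 => kron (Amat α ν) (A1 α)

/-- `Amatt α t ν = A_ν^t`, the ν-fold Kronecker power of `diag(α^t, (1-α)^t)`. -/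
def Amatt (α t : ℝ) : (ν : ℕ) → Matrix (Fin (2 ^ ν)) (Fin (2 ^ ν)) ℂ
  | 0 => 1
  | ν + 1 => kron (Amatt α t ν) (A1t α t)

/-- The state `ρ_ν(x) = Tr (x A_ν)` on `N_ν = M_{2^ν}(ℂ)`. -/
def rho (α : ℝ) (ν : ℕ) (x : Matrix (Fin (2 ^ ν)) (Fin (2 ^ ν)) ℂ) : ℂ :=
  (x * Amat α ν).trace

/-- The state `ρ_1(x) = Tr (x A_1)` on `M_2(ℂ)`. -/
def rho1 (α : ℝ) (x : Matrix (Fin 2) (Fin 2) ℂ) : ℂ :=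
  (x * A1 α).trace

/-- The Schatten `p`-norm `‖x‖_{C_p} = (Tr ((x^* x)^{p/2}))^{1/p}`, `1 ≤ p < ∞`,
computed through the eigenvalues of the positive semidefinite matrix `x^* x`. -/
def schatten {N : ℕ} (p : ℝ) (x : Matrix (Fin N) (Fin N) ℂ) : ℝ :=
  (∑ i, ((Matrix.posSemidef_conjTranspose_mul_self x).isHermitian.eigenvalues i) ^ (p / 2)) ^
    (1 / p)

/-- The operator norm `‖x‖ = ‖x‖_{C_∞}` of a complex matrix (acting on ℓ²). -/
def opNorm {N : ℕ} (x : Matrix (Fin N) (Fin N) ℂ) : ℝ :=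
  ‖Matrix.toEuclideanCLM (𝕜 := ℂ) x‖

/-- The left predual norm `‖x‖_♯ = ‖x A_ν‖_{C_1}` on `N_ν`. -/
def sharpNorm (α : ℝ) {ν : ℕ} (x : Matrix (Fin (2 ^ ν)) (Fin (2 ^ ν)) ℂ) : ℝ :=
  schatten 1 (x * Amat α ν)

/-- The right predual norm `‖x‖_♭ = ‖A_ν x‖_{C_1}` on `N_ν`. -/
def flatNorm (α : ℝ) {ν : ℕ} (x : Matrix (Fin (2 ^ ν)) (Fin (2 ^ ν)) ℂ) : ℝ :=
  schatten 1 (Amat α ν * x)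

/-- The left predual norm `‖x‖_♯ = ‖x A_1‖_{C_1}` on `M_2(ℂ)`. -/
def sharp2 (α : ℝ) (x : Matrix (Fin 2) (Fin 2) ℂ) : ℝ :=
  schatten 1 (x * A1 α)

/-- The right predual norm `‖x‖_♭ = ‖A_1 x‖_{C_1}` on `M_2(ℂ)`. -/
def flat2 (α : ℝ) (x : Matrix (Fin 2) (Fin 2) ℂ) : ℝ :=
  schatten 1 (A1 α * x)

/-- The left norm `‖x‖_{p,♯} = ‖x A_ν^{1/p}‖_{C_p}` on `N_ν`, `1 ≤ p ≤ ∞`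
(for `p = ∞` it is the operator norm). -/
def lpSharp (α : ℝ) (p : ℝ≥0∞) {ν : ℕ} (x : Matrix (Fin (2 ^ ν)) (Fin (2 ^ ν)) ℂ) : ℝ :=
  if p = ∞ then opNorm x else schatten p.toReal (x * Amatt α (1 / p.toReal) ν)

/-- The right norm `‖x‖_{p,♭} = ‖A_ν^{1/p} x‖_{C_p}` on `N_ν`, `1 ≤ p ≤ ∞`. -/
def lpFlat (α : ℝ) (p : ℝ≥0∞) {ν : ℕ} (x : Matrix (Fin (2 ^ ν)) (Fin (2 ^ ν)) ℂ) : ℝ :=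
  if p = ∞ then opNorm x else schatten p.toReal (Amatt α (1 / p.toReal) ν * x)

/-- The left norm `‖x‖_{p,♯} = ‖x A_1^{1/p}‖_{C_p}` on `M_2(ℂ)`. -/
def lp2Sharp (α : ℝ) (p : ℝ≥0∞) (x : Matrix (Fin 2) (Fin 2) ℂ) : ℝ :=
  if p = ∞ then opNorm x else schatten p.toReal (x * A1t α (1 / p.toReal))

/-- `shellNum r c` is `s(r+1, c+1) - 1`, the zero-based shell enumeration index of the
matrix unit `E_{r c}` (zero-based indices `r`, `c`): `s(r,c) = (c-1)² + r` if `r ≤ c`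
and `s(r,c) = r² - c + 1` if `r > c` (one-based). -/
def shellNum (r c : ℕ) : ℕ :=
  if r ≤ c then c * c + r else r * r + 2 * r - c

/-- `eUnit N m` is the `m`-th matrix unit `e_m` of `M_N(ℂ)` in the shell enumeration:
`e_{s(r,c) - 1} = E_{r c}`. -/
def eUnit (N m : ℕ) : Matrix (Fin N) (Fin N) ℂ :=
  Matrix.of fun r c => if shellNum (r : ℕ) (c : ℕ) = m then 1 else 0

/-- The left Haar system `h^{(ν)}_j` in `N_ν` built from `r_0, r_1, r_2, r_3 ∈ M_2(ℂ)`: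
`h^{(1)}_j = r_j`, and for `j = 4^ν q + k` (`0 ≤ q ≤ 3`, `0 ≤ k < 4^ν`),
`h^{(ν+1)}_j = h^{(ν)}_k ⊗ r_0` if `q = 0` and `h^{(ν+1)}_j = e^{(ν)}_k ⊗ r_q` if `q ≠ 0`. -/
def haar (r : ℕ → Matrix (Fin 2) (Fin 2) ℂ) :
    (ν : ℕ) → ℕ → Matrix (Fin (2 ^ ν)) (Fin (2 ^ ν)) ℂ
  | 0, _ => 1
  | 1, j => r (j % 4)
  | ν + 2, j =>
      if j / 4 ^ (ν + 1) = 0 then kron (haar r (ν + 1) j) (r 0)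
      else kron (eUnit (2 ^ (ν + 1)) (j % 4 ^ (ν + 1))) (r (j / 4 ^ (ν + 1) % 4))


section helpers
open scoped Matrix.Norms.L2Operator
open Matrix

lemma tn_entry_le {n : Type*} [Fintype n] [DecidableEq n] (M : Matrix n n ℂ) (i j : n) :
    ‖M i j‖ ≤ ‖M‖ := by
  have h := Matrix.l2_opNorm_mulVec M (EuclideanSpace.single j (1 : ℂ))
  have h2 := PiLp.norm_apply_le ((EuclideanSpace.equiv n ℂ).symm (M *ᵥ (EuclideanSpace.single j (1 : ℂ)))) i
  have h3 := h2.trans h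
  simpa using h3

lemma tn_contr_of_sq {m n : Type*} [Fintype n] [DecidableEq n] [Fintype m]
    (S : Matrix m n ℂ) (v : n → ℂ) (hv : ∀ i, ‖v i‖ ≤ 1)
    (h : Sᴴ * S = diagonal v) : ‖S‖ ≤ 1 := by
  have h1 := Matrix.l2_opNorm_conjTranspose_mul_self S
  rw [h, l2_opNorm_diagonal] at h1
  have h2 : ‖v‖ ≤ 1 := (pi_norm_le_iff_of_nonneg zero_le_one).2 hv
  nlinarith [norm_nonneg S]

lemma tn_one_le {n : Type*} [Fintype n] [DecidableEq n] : ‖(1 : Matrix n n ℂ)‖ ≤ 1 := by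
  refine tn_contr_of_sq _ (fun _ => 1) (by simp) (by simp)

lemma tn_submatrix_le {m n : Type*} [Fintype n] [DecidableEq n] [Fintype m] [DecidableEq m]
    (f : m → n) (hf : Function.Injective f) (M : Matrix n n ℂ) :
    ‖M.submatrix f f‖ ≤ ‖M‖ := by
  set S : Matrix n m ℂ := (1 : Matrix n n ℂ).submatrix id f with hS
  have h1 : ‖S‖ ≤ 1 := by
    refine tn_contr_of_sq S (fun _ => 1) (by simp) ?_
    ext i j
    simp [hS, mul_apply, one_apply, diagonal_apply, hf.eq_iff, eq_comm]
  have h2 : M.submatrix f f = Sᴴ * M * S := by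
    ext i j
    simp [hS, mul_apply, one_apply]
  rw [h2]
  calc _ ≤ ‖Sᴴ * M‖ * ‖S‖ := l2_opNorm_mul _ _
    _ ≤ (‖Sᴴ‖ * ‖M‖) * ‖S‖ := by gcongr; exact l2_opNorm_mul _ _
    _ ≤ (1 * ‖M‖) * 1 := by
      rw [l2_opNorm_conjTranspose]; gcongr
    _ = ‖M‖ := by ring

lemma tn_polar {N : ℕ} (x : Matrix (Fin N) (Fin N) ℂ) :
    ∃ (V u : Matrix (Fin N) (Fin N) ℂ) (s : Fin N → ℝ), V * Vᴴ = 1 ∧ Vᴴ * V = 1 ∧ ‖u‖ ≤ 1 ∧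
      (∀ i, 0 ≤ s i) ∧ schatten 1 x = ∑ i, s i ∧
      x * V = u * diagonal (fun i => (s i : ℂ)) ∧
      uᴴ * u * diagonal (fun i => (s i : ℂ)) = diagonal (fun i => (s i : ℂ)) := by
  have hps := Matrix.posSemidef_conjTranspose_mul_self x
  set hA := hps.isHermitian with hAdef
  set V : Matrix (Fin N) (Fin N) ℂ := (hA.eigenvectorUnitary : Matrix (Fin N) (Fin N) ℂ) with hV
  have hVV : V * Vᴴ = 1 := Unitary.mul_star_self_of_mem hA.eigenvectorUnitary.2
  have hVV' : Vᴴ * V = 1 := Unitary.star_mul_self_of_mem hA.eigenvectorUnitary.2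
  set s : Fin N → ℝ := fun i => Real.sqrt (hA.eigenvalues i) with hs
  have hs2 : ∀ i, s i * s i = hA.eigenvalues i := fun i =>
    Real.mul_self_sqrt (hps.eigenvalues_nonneg i)
  have hsp : Vᴴ * (xᴴ * x) * V = diagonal (fun i => (s i : ℂ) * (s i : ℂ)) := by
    have := hA.conjStarAlgAut_star_eigenvectorUnitary
    rw [Unitary.conjStarAlgAut_star_apply] at this
    rw [← star_eq_conjTranspose V, hV, this]
    congr 1
    ext i
    simp only [Function.comp]
    rw [← hs2 i]; simp
  set Di : Matrix (Fin N) (Fin N) ℂ := diagonal (fun i => ((s i)⁻¹ : ℂ)) with hDi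
  have hDiH : Diᴴ = Di := by
    rw [hDi, diagonal_conjTranspose]; congr 1; ext i; simp
  set u := x * V * Di with hu
  have hW : (x * V)ᴴ * (x * V) = diagonal (fun i => (s i : ℂ) * (s i : ℂ)) := by
    rw [← hsp, conjTranspose_mul]; simp only [Matrix.mul_assoc]
  have huu : uᴴ * u = diagonal (fun i => if s i = 0 then (0 : ℂ) else 1) := by
    have : uᴴ * u = Di * ((x * V)ᴴ * (x * V)) * Di := by
      rw [hu, conjTranspose_mul (x * V), hDiH]; simp only [Matrix.mul_assoc]
    rw [this, hW, hDi, diagonal_mul_diagonal, diagonal_mul_diagonal]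
    congr 1; ext i
    split_ifs with h
    · simp [h]
    · have : (s i : ℂ) ≠ 0 := by exact_mod_cast h
      field_simp
  refine ⟨V, u, s, hVV, hVV', ?_, fun i => Real.sqrt_nonneg _, ?_, ?_, ?_⟩
  · refine tn_contr_of_sq u _ ?_ huu
    intro i; split_ifs <;> simp
  · simp only [schatten, hs, Real.sqrt_eq_rpow]
    simp
  · rw [← sub_eq_zero, ← conjTranspose_mul_self_eq_zero]
    have : x * V - u * diagonal (fun i => (s i : ℂ)) =
        (x * V) * diagonal (fun i => if s i = 0 then (1 : ℂ) else 0) := by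
      rw [hu, Matrix.mul_assoc (x * V), hDi, diagonal_mul_diagonal]
      conv_lhs => rw [← Matrix.mul_one (x * V)]
      rw [Matrix.mul_assoc (x * V), ← Matrix.mul_sub, Matrix.one_mul, ← diagonal_one,
        diagonal_sub]
      congr 2; ext i
      split_ifs with h
      · simp [h]
      · have : (s i : ℂ) ≠ 0 := by exact_mod_cast h
        simp [this]
    rw [this, conjTranspose_mul, Matrix.mul_assoc, ← Matrix.mul_assoc _ (x * V), hW,
      diagonal_conjTranspose, diagonal_mul_diagonal, diagonal_mul_diagonal, ← diagonal_zero]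
    congr 1; ext i
    by_cases h : s i = 0 <;> simp [h]
  · rw [huu, diagonal_mul_diagonal]
    congr 1; ext i
    by_cases h : s i = 0 <;> simp [h]

lemma tn_dual_le {N : ℕ} (x y : Matrix (Fin N) (Fin N) ℂ) :
    ‖(x * y).trace‖ ≤ schatten 1 x * ‖y‖ := by
  obtain ⟨V, u, s, h1, h2, hu, hs, hsx, hx, -⟩ := tn_polar x
  have hV : ‖Vᴴ‖ ≤ 1 := by
    rw [l2_opNorm_conjTranspose]
    exact tn_contr_of_sq V (fun _ => 1) (by simp) (by rw [h2]; simp)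
  have e : (x * y).trace = ∑ i, (Vᴴ * y * u) i i * (s i : ℂ) := by
    calc (x * y).trace = (x * (V * Vᴴ) * y).trace := by rw [h1, Matrix.mul_one]
      _ = ((x * V) * (Vᴴ * y)).trace := by simp only [Matrix.mul_assoc]
      _ = (Vᴴ * y * u * diagonal (fun i => (s i : ℂ))).trace := by
        rw [hx, trace_mul_comm]; simp only [Matrix.mul_assoc]
      _ = _ := by simp [trace, mul_diagonal]
  have hM : ‖Vᴴ * y * u‖ ≤ ‖y‖ := by
    calc _ ≤ ‖Vᴴ * y‖ * ‖u‖ := l2_opNorm_mul _ _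
      _ ≤ (‖Vᴴ‖ * ‖y‖) * ‖u‖ := by gcongr; exact l2_opNorm_mul _ _
      _ ≤ (1 * ‖y‖) * 1 := by gcongr
      _ = ‖y‖ := by ring
  rw [e, hsx, Finset.sum_mul]
  refine (norm_sum_le _ _).trans (Finset.sum_le_sum fun i _ => ?_)
  rw [norm_mul, mul_comm, Complex.norm_real, Real.norm_of_nonneg (hs i)]
  exact mul_le_mul_of_nonneg_left ((tn_entry_le _ i i).trans hM) (hs i)

lemma tn_nonneg {N : ℕ} (x : Matrix (Fin N) (Fin N) ℂ) : 0 ≤ schatten 1 x := by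
  obtain ⟨V, u, s, h1, h2, hu, hs, hsx, hx, -⟩ := tn_polar x
  rw [hsx]; exact Finset.sum_nonneg fun i _ => hs i

lemma tn_le_of {N : ℕ} (x : Matrix (Fin N) (Fin N) ℂ) (C : ℝ)
    (h : ∀ y : Matrix (Fin N) (Fin N) ℂ, ‖y‖ ≤ 1 → ‖(x * y).trace‖ ≤ C) : schatten 1 x ≤ C := by
  obtain ⟨V, u, s, h1, h2, hu, hs, hsx, hx, hud⟩ := tn_polar x
  have hV : ‖V‖ ≤ 1 := tn_contr_of_sq V (fun _ => 1) (by simp) (by rw [h2]; simp)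
  have hy : ‖V * uᴴ‖ ≤ 1 := by
    refine (l2_opNorm_mul _ _).trans ?_
    rw [l2_opNorm_conjTranspose]
    exact mul_le_one₀ hV (norm_nonneg _) hu
  have h3 := h _ hy
  have e : (x * (V * uᴴ)).trace = ((∑ i, s i : ℝ) : ℂ) := by
    rw [← Matrix.mul_assoc, hx, trace_mul_comm, ← Matrix.mul_assoc, hud]
    simp [trace]
  rw [e, Complex.norm_real, ← hsx] at h3
  exact (le_abs_self _).trans h3

lemma tn_add_le {N : ℕ} (x y : Matrix (Fin N) (Fin N) ℂ) :
    schatten 1 (x + y) ≤ schatten 1 x + schatten 1 y := by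
  refine tn_le_of _ _ fun z hz => ?_
  rw [Matrix.add_mul, trace_add]
  refine (norm_add_le _ _).trans (add_le_add ?_ ?_)
  · exact (tn_dual_le x z).trans (mul_le_of_le_one_right (tn_nonneg _) hz)
  · exact (tn_dual_le y z).trans (mul_le_of_le_one_right (tn_nonneg _) hz)

lemma tn_smul_le {N : ℕ} (a : ℂ) (x : Matrix (Fin N) (Fin N) ℂ) :
    schatten 1 (a • x) ≤ ‖a‖ * schatten 1 x := by
  refine tn_le_of _ _ fun z hz => ?_
  rw [Matrix.smul_mul, trace_smul, norm_smul]
  gcongr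
  exact (tn_dual_le x z).trans (mul_le_of_le_one_right (tn_nonneg _) hz)

lemma tn_zero {N : ℕ} : schatten 1 (0 : Matrix (Fin N) (Fin N) ℂ) = 0 := by
  refine le_antisymm (tn_le_of _ _ fun z hz => by simp) (tn_nonneg _)

lemma tn_sum_le {N : ℕ} {ι : Type*} (s : Finset ι) (f : ι → Matrix (Fin N) (Fin N) ℂ) :
    schatten 1 (∑ i ∈ s, f i) ≤ ∑ i ∈ s, schatten 1 (f i) :=
  Finset.le_sum_of_subadditive _ tn_zero.le tn_add_le s f

lemma tn_mul_le {N : ℕ} (p x q : Matrix (Fin N) (Fin N) ℂ) (hp : ‖p‖ ≤ 1) (hq : ‖q‖ ≤ 1) :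
    schatten 1 (p * x * q) ≤ schatten 1 x := by
  refine tn_le_of _ _ fun z hz => ?_
  have : (p * x * q * z).trace = (x * (q * z * p)).trace := by
    rw [Matrix.mul_assoc, Matrix.mul_assoc, trace_mul_comm]; simp only [Matrix.mul_assoc]
  rw [this]
  refine (tn_dual_le _ _).trans (mul_le_of_le_one_right (tn_nonneg _) ?_)
  calc _ ≤ ‖q * z‖ * ‖p‖ := l2_opNorm_mul _ _
    _ ≤ (‖q‖ * ‖z‖) * ‖p‖ := by gcongr; exact l2_opNorm_mul _ _
    _ ≤ (1 * 1) * 1 := by gcongr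
    _ = 1 := by ring

lemma tn_mask_le {N : ℕ} (P Q : Fin N → Prop) [DecidablePred P] [DecidablePred Q]
    (x : Matrix (Fin N) (Fin N) ℂ) :
    schatten 1 (Matrix.of fun i j => if P i ∧ Q j then x i j else 0) ≤ schatten 1 x := by
  have : (Matrix.of fun i j => if P i ∧ Q j then x i j else 0) =
      diagonal (fun i => if P i then (1 : ℂ) else 0) * x *
        diagonal (fun i => if Q i then (1 : ℂ) else 0) := by
    ext i j
    rw [mul_diagonal, diagonal_mul]
    by_cases h1 : P i <;> by_cases h2 : Q j <;> simp [h1, h2]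
  rw [this]
  refine tn_mul_le _ _ _ ?_ ?_ <;>
  · rw [l2_opNorm_diagonal, pi_norm_le_iff_of_nonneg zero_le_one]
    intro i; split_ifs <;> simp

lemma shell_mask_le {N : ℕ} (K : ℕ) (x : Matrix (Fin N) (Fin N) ℂ) :
    schatten 1 (Matrix.of fun i j : Fin N => if shellNum i j < K then x i j else 0) ≤
      2 * schatten 1 x := by
  set n := Nat.sqrt K with hn
  have h1 : n * n ≤ K := Nat.sqrt_le K
  have h2 : K ≤ n * n + n + n := Nat.sqrt_le_add K
  have key : ∀ (P Q P' Q' : ℕ → Prop) [DecidablePred P] [DecidablePred Q] [DecidablePred P']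
      [DecidablePred Q'], (∀ i j, shellNum i j < K ↔ ((P i ∧ Q j) ∨ (P' i ∧ Q' j))) →
      (∀ i j, ¬ ((P i ∧ Q j) ∧ (P' i ∧ Q' j))) →
      schatten 1 (Matrix.of fun i j : Fin N => if shellNum i j < K then x i j else 0) ≤
      2 * schatten 1 x := by
    intro P Q P' Q' _ _ _ _ h h'
    have e : (Matrix.of fun i j : Fin N => if shellNum i j < K then x i j else 0) =
        (Matrix.of fun i j : Fin N => if P i ∧ Q j then x i j else 0) +
        (Matrix.of fun i j : Fin N => if P' i ∧ Q' j then x i j else 0) := by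
      ext i j
      have a := h i j
      have b := h' i j
      simp only [of_apply, Matrix.add_apply, a]
      by_cases c : P i ∧ Q j <;> by_cases d : P' i ∧ Q' j <;> simp [c, d]
      exact absurd ⟨c, d⟩ b
    rw [e, two_mul]
    exact (tn_add_le _ _).trans (add_le_add
      (tn_mask_le (fun i : Fin N => P i) (fun j : Fin N => Q j) x)
      (tn_mask_le (fun i : Fin N => P' i) (fun j : Fin N => Q' j) x))
  by_cases hK : K ≤ n * n + n
  · refine key (· < n) (· < n) (fun i => n * n + i < K) (· = n) ?_ ?_
    · intro i j
      unfold shellNum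
      split_ifs with hij
      · constructor
        · intro h
          have : j ≤ n := by by_contra hc; push Not at hc; nlinarith
          rcases this.lt_or_eq with h3 | h3
          · left; omega
          · right; subst h3; exact ⟨h, rfl⟩
        · rintro (⟨a, b⟩ | ⟨a, b⟩)
          · nlinarith
          · subst b; exact a
      · push Not at hij
        constructor
        · intro h
          left
          have h4 : i < n := by
            by_contra hc; push Not at hc
            have : n * n ≤ i * i := Nat.mul_self_le_mul_self hc
            omega
          omega
        · rintro (⟨a, b⟩ | ⟨a, b⟩)
          · have : (i + 1) * (i + 1) ≤ n * n := Nat.mul_self_le_mul_self a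
            have : i * i + 2 * i < n * n := by nlinarith
            omega
          · subst b; omega
    · rintro i j ⟨⟨a, b⟩, ⟨c, d⟩⟩; omega
  · push Not at hK
    refine key (· < n) (· ≤ n) (· = n) (fun j => j ≤ n ∧ n * n + 2 * n - j < K) ?_ ?_
    · intro i j
      unfold shellNum
      split_ifs with hij
      · constructor
        · intro h
          have : j ≤ n := by by_contra hc; push Not at hc; nlinarith
          by_cases h3 : i < n
          · left; omega
          · right; have : i = n := by omega
            have : j = n := by omega
            subst this; omega
        · rintro (⟨a, b⟩ | ⟨a, b⟩)
          · have : j * j ≤ n * n := Nat.mul_self_le_mul_self b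
            omega
          · have : j = n := by omega
            subst this; omega
      · push Not at hij
        constructor
        · intro h
          have h4 : i ≤ n := by
            by_contra hc; push Not at hc
            have : (n + 1) * (n + 1) ≤ i * i := Nat.mul_self_le_mul_self hc
            have : n * n + 2 * n + 1 ≤ i * i := by nlinarith
            omega
          rcases h4.lt_or_eq with h3 | h3
          · left; omega
          · right; subst h3; omega
        · rintro (⟨a, b⟩ | ⟨a, b⟩)
          · have : (i + 1) * (i + 1) ≤ n * n := Nat.mul_self_le_mul_self a
            have : i * i + 2 * i < n * n := by nlinarith
            omega
          · subst a; exact b.2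
    · rintro i j ⟨⟨a, b⟩, ⟨c, d⟩⟩; omega

lemma kron_apply' {m n : ℕ} (x : Matrix (Fin m) (Fin m) ℂ) (y : Matrix (Fin n) (Fin n) ℂ)
    (i j : Fin m) (k l : Fin n) :
    kron x y (finProdFinEquiv (i, k)) (finProdFinEquiv (j, l)) = x i j * y k l := by
  simp [kron, kroneckerMap_apply]

lemma kron_mul_kron {m n : ℕ} (x x' : Matrix (Fin m) (Fin m) ℂ) (y y' : Matrix (Fin n) (Fin n) ℂ) :
    kron x y * kron x' y' = kron (x * x') (y * y') := by
  simp only [kron, reindex_apply, submatrix_mul_equiv, mul_kronecker_mul]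

lemma trace_eq_prod {m n : ℕ} (w : Matrix (Fin (m * n)) (Fin (m * n)) ℂ) :
    w.trace = ∑ i : Fin m, ∑ k : Fin n, w (finProdFinEquiv (i, k)) (finProdFinEquiv (i, k)) := by
  rw [trace, ← finProdFinEquiv.sum_comp, Fintype.sum_prod_type]
  rfl

lemma kron_trace {m n : ℕ} (x : Matrix (Fin m) (Fin m) ℂ) (y : Matrix (Fin n) (Fin n) ℂ) :
    (kron x y).trace = x.trace * y.trace := by
  rw [trace_eq_prod]
  simp only [kron_apply', trace, diag_apply, Finset.sum_mul_sum]

lemma kron_ext {m n : ℕ} {x y : Matrix (Fin (m * n)) (Fin (m * n)) ℂ}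
    (h : ∀ i j k l, x (finProdFinEquiv (i, k)) (finProdFinEquiv (j, l)) =
      y (finProdFinEquiv (i, k)) (finProdFinEquiv (j, l))) : x = y := by
  ext a b
  obtain ⟨⟨i, k⟩, rfl⟩ := finProdFinEquiv.surjective a
  obtain ⟨⟨j, l⟩, rfl⟩ := finProdFinEquiv.surjective b
  exact h i j k l

lemma kron_one_one {m n : ℕ} :
    kron (1 : Matrix (Fin m) (Fin m) ℂ) (1 : Matrix (Fin n) (Fin n) ℂ) = 1 := by
  simp [kron]

lemma kron_add_left {m n : ℕ} (x x' : Matrix (Fin m) (Fin m) ℂ) (y : Matrix (Fin n) (Fin n) ℂ) :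
    kron (x + x') y = kron x y + kron x' y :=
  kron_ext fun i j k l => by simp only [kron_apply', Matrix.add_apply, add_mul]

lemma kron_add_right {m n : ℕ} (x : Matrix (Fin m) (Fin m) ℂ) (y y' : Matrix (Fin n) (Fin n) ℂ) :
    kron x (y + y') = kron x y + kron x y' :=
  kron_ext fun i j k l => by simp only [kron_apply', Matrix.add_apply, mul_add]

lemma kron_zero_left {m n : ℕ} (y : Matrix (Fin n) (Fin n) ℂ) :
    kron (0 : Matrix (Fin m) (Fin m) ℂ) y = 0 :=
  kron_ext fun i j k l => by simp [kron_apply']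

lemma kron_zero_right {m n : ℕ} (y : Matrix (Fin n) (Fin n) ℂ) :
    kron y (0 : Matrix (Fin m) (Fin m) ℂ) = 0 :=
  kron_ext fun i j k l => by simp [kron_apply']

lemma kron_smul_left {m n : ℕ} (a : ℂ) (x : Matrix (Fin m) (Fin m) ℂ)
    (y : Matrix (Fin n) (Fin n) ℂ) : kron (a • x) y = a • kron x y :=
  kron_ext fun i j k l => by simp [kron_apply', mul_assoc]

lemma kron_smul_right {m n : ℕ} (a : ℂ) (x : Matrix (Fin m) (Fin m) ℂ)
    (y : Matrix (Fin n) (Fin n) ℂ) : kron x (a • y) = a • kron x y :=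
  kron_ext fun i j k l => by simp [kron_apply', mul_left_comm]

lemma kron_sum_left {m n : ℕ} {ι : Type*} (s : Finset ι) (f : ι → Matrix (Fin m) (Fin m) ℂ)
    (y : Matrix (Fin n) (Fin n) ℂ) : kron (∑ i ∈ s, f i) y = ∑ i ∈ s, kron (f i) y :=
  kron_ext fun i j k l => by simp only [kron_apply', Matrix.sum_apply, Finset.sum_mul]

lemma kron_star {m n : ℕ} (x : Matrix (Fin m) (Fin m) ℂ) (y : Matrix (Fin n) (Fin n) ℂ) :
    kron xᴴ yᴴ = (kron x y)ᴴ :=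
  kron_ext fun i j k l => by simp only [kron_apply', conjTranspose_apply, star_mul']

/-- `a ↦ a ⊗ 1` as a star homomorphism. -/
def kronL (m n : ℕ) : Matrix (Fin m) (Fin m) ℂ →⋆ₐ[ℂ] Matrix (Fin (m * n)) (Fin (m * n)) ℂ where
  toFun x := kron x 1
  map_one' := kron_one_one
  map_mul' x y := by rw [kron_mul_kron, Matrix.one_mul]
  map_zero' := kron_zero_left _
  map_add' x y := kron_add_left _ _ _
  commutes' a := by
    simp only [Algebra.algebraMap_eq_smul_one, kron_smul_left, kron_one_one]
  map_star' x := by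
    simp only [star_eq_conjTranspose, ← kron_star, conjTranspose_one]

/-- `b ↦ 1 ⊗ b` as a star homomorphism. -/
def kronR (m n : ℕ) : Matrix (Fin n) (Fin n) ℂ →⋆ₐ[ℂ] Matrix (Fin (m * n)) (Fin (m * n)) ℂ where
  toFun x := kron 1 x
  map_one' := kron_one_one
  map_mul' x y := by rw [kron_mul_kron, Matrix.one_mul]
  map_zero' := kron_zero_right _
  map_add' x y := kron_add_right _ _ _
  commutes' a := by
    simp only [Algebra.algebraMap_eq_smul_one, kron_smul_right, kron_one_one]
  map_star' x := by
    simp only [star_eq_conjTranspose, ← kron_star, conjTranspose_one]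

lemma kron_norm_le {m n : ℕ} (x : Matrix (Fin m) (Fin m) ℂ) (y : Matrix (Fin n) (Fin n) ℂ) :
    ‖kron x y‖ ≤ ‖x‖ * ‖y‖ := by
  have h : kron x y = kron x 1 * kron 1 y := by
    rw [kron_mul_kron, Matrix.one_mul, Matrix.mul_one]
  rw [h]
  have h1 : ‖kron x (1 : Matrix (Fin n) (Fin n) ℂ)‖ ≤ ‖x‖ :=
    NonUnitalStarAlgHom.norm_apply_le (kronL m n) x
  have h2 : ‖kron (1 : Matrix (Fin m) (Fin m) ℂ) y‖ ≤ ‖y‖ :=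
    NonUnitalStarAlgHom.norm_apply_le (kronR m n) y
  exact (l2_opNorm_mul _ _).trans (by gcongr)

lemma tn_kron_le (α : ℝ) (hα0 : 0 < α) (hα : α ≤ 1 / 2) {m : ℕ} (a : Matrix (Fin m) (Fin m) ℂ)
    (r : Matrix (Fin 2) (Fin 2) ℂ) :
    schatten 1 (kron a (A1 α * r)) ≤ schatten 1 a * ‖r‖ := by
  refine tn_le_of _ _ fun z hz => ?_
  set w := kron (1 : Matrix (Fin m) (Fin m) ℂ) r * z with hw
  have hwn : ‖w‖ ≤ ‖r‖ := by
    calc _ ≤ ‖kron (1 : Matrix (Fin m) (Fin m) ℂ) r‖ * ‖z‖ := l2_opNorm_mul _ _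
      _ ≤ (‖(1 : Matrix (Fin m) (Fin m) ℂ)‖ * ‖r‖) * ‖z‖ := by gcongr; exact kron_norm_le _ _
      _ ≤ (1 * ‖r‖) * 1 := by gcongr; exact tn_one_le
      _ = ‖r‖ := by ring
  have e1 : kron a (A1 α * r) * z = kron a (A1 α) * w := by
    rw [hw, ← Matrix.mul_assoc, kron_mul_kron, Matrix.mul_one]
  let f : Fin 2 → Fin m → Fin (m * 2) := fun i k => finProdFinEquiv (k, i)
  have hf : ∀ i, Function.Injective (f i) := by
    intro i k l h
    have := finProdFinEquiv.injective h
    exact (Prod.mk.inj this).1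
  have e2 : (kron a (A1 α) * w).trace =
      (α : ℂ) * (a * w.submatrix (f 0) (f 0)).trace +
      ((1 - α : ℝ) : ℂ) * (a * w.submatrix (f 1) (f 1)).trace := by
    rw [trace_eq_prod]
    simp only [Fin.sum_univ_two, trace, diag_apply, mul_apply, submatrix_apply]
    simp only [Finset.mul_sum, ← Finset.sum_add_distrib]
    refine Finset.sum_congr rfl fun i _ => ?_
    rw [← finProdFinEquiv.sum_comp, Fintype.sum_prod_type]
    refine Finset.sum_congr rfl fun j _ => ?_
    simp only [Fin.sum_univ_two, kron_apply', A1, f]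
    simp
    ring
  have hb : ∀ i, ‖(a * w.submatrix (f i) (f i)).trace‖ ≤ schatten 1 a * ‖r‖ := fun i =>
    (tn_dual_le _ _).trans (mul_le_mul_of_nonneg_left
      ((tn_submatrix_le _ (hf i) _).trans hwn) (tn_nonneg _))
  rw [e1, e2]
  refine (norm_add_le _ _).trans ?_
  rw [norm_mul, norm_mul, Complex.norm_real, Complex.norm_real, Real.norm_of_nonneg hα0.le,
    Real.norm_of_nonneg (by linarith : (0 : ℝ) ≤ 1 - α)]
  nlinarith [mul_le_mul_of_nonneg_left (hb 0) hα0.le,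
    mul_le_mul_of_nonneg_left (hb 1) (by linarith : (0 : ℝ) ≤ 1 - α)]

/-- The Kronecker product with a `2 × 2` matrix, typed on `Fin (2 ^ (ν + 1))`. -/
def kr {ν : ℕ} (y : Matrix (Fin (2 ^ ν)) (Fin (2 ^ ν)) ℂ) (r : Matrix (Fin 2) (Fin 2) ℂ) :
    Matrix (Fin (2 ^ (ν + 1))) (Fin (2 ^ (ν + 1))) ℂ := kron y r

lemma kr_mul {ν : ℕ} (y y' : Matrix (Fin (2 ^ ν)) (Fin (2 ^ ν)) ℂ)
    (r r' : Matrix (Fin 2) (Fin 2) ℂ) : kr y r * kr y' r' = kr (y * y') (r * r') :=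
  kron_mul_kron _ _ _ _

lemma kr_Amat (α : ℝ) (ν : ℕ) : Amat α (ν + 1) = kr (Amat α ν) (A1 α) := rfl

lemma kr_trace {ν : ℕ} (y : Matrix (Fin (2 ^ ν)) (Fin (2 ^ ν)) ℂ)
    (r : Matrix (Fin 2) (Fin 2) ℂ) : (kr y r).trace = y.trace * r.trace :=
  kron_trace _ _

lemma kr_norm_le {ν : ℕ} (y : Matrix (Fin (2 ^ ν)) (Fin (2 ^ ν)) ℂ)
    (r : Matrix (Fin 2) (Fin 2) ℂ) : ‖kr y r‖ ≤ ‖y‖ * ‖r‖ :=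
  kron_norm_le _ _

lemma kr_smul_left {ν : ℕ} (a : ℂ) (y : Matrix (Fin (2 ^ ν)) (Fin (2 ^ ν)) ℂ)
    (r : Matrix (Fin 2) (Fin 2) ℂ) : kr (a • y) r = a • kr y r :=
  kron_smul_left _ _ _

lemma kr_sum_left {ν : ℕ} {ι : Type*} (s : Finset ι)
    (f : ι → Matrix (Fin (2 ^ ν)) (Fin (2 ^ ν)) ℂ)
    (r : Matrix (Fin 2) (Fin 2) ℂ) : kr (∑ i ∈ s, f i) r = ∑ i ∈ s, kr (f i) r :=
  kron_sum_left _ _ _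

lemma flat_kr_le (α : ℝ) (hα0 : 0 < α) (hα : α ≤ 1 / 2) {ν : ℕ}
    (y : Matrix (Fin (2 ^ ν)) (Fin (2 ^ ν)) ℂ) (r : Matrix (Fin 2) (Fin 2) ℂ) :
    flatNorm α (kr y r) ≤ flatNorm α y * opNorm r := by
  unfold flatNorm
  rw [kr_Amat, kr_mul]
  exact tn_kron_le α hα0 hα _ _

lemma kron_diag {m n : ℕ} (a : Fin m → ℂ) (b : Fin n → ℂ) :
    ∃ d, kron (diagonal a) (diagonal b) = diagonal d :=
  ⟨_, by rw [kron, diagonal_kronecker_diagonal, reindex_apply, submatrix_diagonal_equiv]⟩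

lemma Amat_diag (α : ℝ) (ν : ℕ) : ∃ d, Amat α ν = diagonal d := by
  induction ν with
  | zero => exact ⟨fun _ => 1, by simp [Amat]⟩
  | succ ν ih =>
    obtain ⟨d, hd⟩ := ih
    rw [kr_Amat, hd]
    exact kron_diag _ _

lemma flat_add_le (α : ℝ) {ν : ℕ} (x y : Matrix (Fin (2 ^ ν)) (Fin (2 ^ ν)) ℂ) :
    flatNorm α (x + y) ≤ flatNorm α x + flatNorm α y := by
  unfold flatNorm; rw [Matrix.mul_add]; exact tn_add_le _ _

/-- Partial sums of matrix units in the shell order are masks. -/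
lemma eUnit_sum {N : ℕ} (K : ℕ) (b : ℕ → ℂ) :
    ∑ k ∈ Finset.range K, b k • eUnit N k =
      Matrix.of fun i j : Fin N => if shellNum i j < K then b (shellNum i j) else 0 := by
  ext i j
  simp only [Matrix.sum_apply, Matrix.smul_apply, eUnit, of_apply, smul_eq_mul, mul_ite, mul_one,
    mul_zero, Finset.sum_ite_eq, Finset.mem_range]

lemma shellNum_lt {N : ℕ} (i j : Fin N) : shellNum i j < N * N := by
  have hi := i.2
  have hj := j.2
  unfold shellNum
  split_ifs with h
  · nlinarith
  · have : ((i : ℕ) + 1) * (i + 1) ≤ N * N := Nat.mul_self_le_mul_self hi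
    have : (i : ℕ) * i + 2 * i < N * N := by nlinarith
    omega

lemma flat_eUnit_le (α : ℝ) {ν : ℕ} (K : ℕ) (b : ℕ → ℂ) :
    flatNorm α (∑ k ∈ Finset.range K, b k • eUnit (2 ^ ν) k) ≤
      2 * flatNorm α (∑ k ∈ Finset.range (4 ^ ν), b k • eUnit (2 ^ ν) k) := by
  obtain ⟨d, hd⟩ := Amat_diag α ν
  have h4 : (4 : ℕ) ^ ν = 2 ^ ν * 2 ^ ν := by rw [← mul_pow]; norm_num
  unfold flatNorm
  have e : Amat α ν * (∑ k ∈ Finset.range K, b k • eUnit (2 ^ ν) k) =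
      Matrix.of fun i j : Fin (2 ^ ν) => if shellNum i j < K then
        (Amat α ν * ∑ k ∈ Finset.range (4 ^ ν), b k • eUnit (2 ^ ν) k) i j else 0 := by
    ext i j
    rw [eUnit_sum, eUnit_sum, hd]
    simp only [diagonal_mul, of_apply, h4, shellNum_lt, if_true, mul_ite, mul_zero]
  rw [e]
  exact shell_mask_le K _

lemma sum_four (q : ℕ) (hq : q < 4) (x : ℕ → ℂ) :
    ∑ p ∈ Finset.range 4, x p * (if p = q then 1 else 0) = x q := by
  simp [hq]

lemma coeff_le (α : ℝ) (r : ℕ → Matrix (Fin 2) (Fin 2) ℂ)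
    (hr : ∀ j < 4, ∀ k < 4, rho1 α (r j * (r k)ᴴ) = if j = k then 1 else 0)
    {ν : ℕ} (y : ℕ → Matrix (Fin (2 ^ ν)) (Fin (2 ^ ν)) ℂ) (q : ℕ) (hq : q < 4) :
    flatNorm α (y q) ≤
      opNorm (r q) * flatNorm α (∑ p ∈ Finset.range 4, kr (y p) (r p)) := by
  refine tn_le_of _ _ fun z hz => ?_
  have e : (Amat α ν * y q * z).trace =
      (Amat α (ν + 1) * (∑ p ∈ Finset.range 4, kr (y p) (r p)) * kr z (r q)ᴴ).trace := by
    rw [kr_Amat, Finset.mul_sum, Finset.sum_mul, trace_sum, ← sum_four q hq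
      (fun p => (Amat α ν * y p * z).trace)]
    refine Finset.sum_congr rfl fun p hp => ?_
    rw [kr_mul, kr_mul, kr_trace, ← hr p (Finset.mem_range.1 hp) q hq, rho1]
    congr 1
    rw [trace_mul_comm, Matrix.mul_assoc]
  rw [e, mul_comm]
  refine (tn_dual_le _ _).trans (mul_le_mul_of_nonneg_left ?_ (tn_nonneg _))
  refine (kr_norm_le _ _).trans ?_
  rw [l2_opNorm_conjTranspose]
  exact mul_le_of_le_one_left (norm_nonneg _) hz

lemma coeff2_le (α : ℝ) (r : ℕ → Matrix (Fin 2) (Fin 2) ℂ)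
    (hr : ∀ j < 4, ∀ k < 4, rho1 α (r j * (r k)ᴴ) = if j = k then 1 else 0)
    (a : ℕ → ℂ) (q : ℕ) (hq : q < 4) :
    ‖a q‖ ≤ opNorm (r q) * flat2 α (∑ p ∈ Finset.range 4, a p • r p) := by
  have e : a q = (A1 α * (∑ p ∈ Finset.range 4, a p • r p) * (r q)ᴴ).trace := by
    rw [Finset.mul_sum, Finset.sum_mul, trace_sum]
    rw [← sum_four q hq a]
    refine Finset.sum_congr rfl fun p hp => ?_
    rw [← hr p (Finset.mem_range.1 hp) q hq, rho1, Matrix.mul_smul, Matrix.smul_mul, trace_smul,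
      smul_eq_mul]
    congr 1
    rw [trace_mul_comm, Matrix.mul_assoc]
  rw [e, mul_comm]
  refine (tn_dual_le _ _).trans_eq ?_
  rw [l2_opNorm_conjTranspose]
  rfl

lemma haar_eq (r : ℕ → Matrix (Fin 2) (Fin 2) ℂ) (n j : ℕ) :
    haar r (n + 2) j = if j / 4 ^ (n + 1) = 0 then kr (haar r (n + 1) j) (r 0)
      else kr (eUnit (2 ^ (n + 1)) (j % 4 ^ (n + 1))) (r (j / 4 ^ (n + 1) % 4)) := by
  simp only [haar]; rfl

lemma haar_low (r : ℕ → Matrix (Fin 2) (Fin 2) ℂ) (n j : ℕ) (hj : j < 4 ^ (n + 1)) :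
    haar r (n + 2) j = kr (haar r (n + 1) j) (r 0) := by
  rw [haar_eq, if_pos (Nat.div_eq_of_lt hj)]

lemma haar_high (r : ℕ → Matrix (Fin 2) (Fin 2) ℂ) (n q k : ℕ) (hq : q ≠ 0) (hq4 : q < 4)
    (hk : k < 4 ^ (n + 1)) :
    haar r (n + 2) (4 ^ (n + 1) * q + k) = kr (eUnit (2 ^ (n + 1)) k) (r q) := by
  have h1 : (4 ^ (n + 1) * q + k) / 4 ^ (n + 1) = q := by
    rw [Nat.mul_add_div (by positivity), Nat.div_eq_of_lt hk, add_zero]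
  have h2 : (4 ^ (n + 1) * q + k) % 4 ^ (n + 1) = k := by
    rw [Nat.mul_add_mod, Nat.mod_eq_of_lt hk]
  rw [haar_eq, h1, h2, if_neg hq, Nat.mod_eq_of_lt hq4]

/-- The `q`-th block of the first coefficients, truncated at `K`. -/
def blk (r : ℕ → Matrix (Fin 2) (Fin 2) ℂ) (n : ℕ) (a : ℕ → ℂ) (q K : ℕ) :
    Matrix (Fin (2 ^ (n + 1))) (Fin (2 ^ (n + 1))) ℂ :=
  if q = 0 then ∑ k ∈ Finset.range K, a k • haar r (n + 1) k
  else ∑ k ∈ Finset.range K, a (4 ^ (n + 1) * q + k) • eUnit (2 ^ (n + 1)) k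

lemma blk_sum (r : ℕ → Matrix (Fin 2) (Fin 2) ℂ) (n : ℕ) (a : ℕ → ℂ) (q K : ℕ) (hq : q < 4)
    (hK : K ≤ 4 ^ (n + 1)) :
    ∑ k ∈ Finset.range K, a (4 ^ (n + 1) * q + k) • haar r (n + 2) (4 ^ (n + 1) * q + k) =
      kr (blk r n a q K) (r q) := by
  unfold blk
  split_ifs with h
  · subst h
    rw [kr_sum_left]
    refine Finset.sum_congr rfl fun k hk => ?_
    have hk' := (Finset.mem_range.1 hk).trans_le hK
    rw [kr_smul_left, Nat.mul_zero, Nat.zero_add, haar_low r n k hk']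
  · rw [kr_sum_left]
    refine Finset.sum_congr rfl fun k hk => ?_
    have hk' := (Finset.mem_range.1 hk).trans_le hK
    rw [kr_smul_left, haar_high r n q k h hq hk']

lemma haar_sum_full (r : ℕ → Matrix (Fin 2) (Fin 2) ℂ) (n : ℕ) (a : ℕ → ℂ) (q : ℕ) (hq : q ≤ 4) :
    ∑ j ∈ Finset.range (4 ^ (n + 1) * q), a j • haar r (n + 2) j =
      ∑ p ∈ Finset.range q, kr (blk r n a p (4 ^ (n + 1))) (r p) := by
  induction q with
  | zero => simp
  | succ q ih =>
    rw [Nat.mul_succ, Finset.sum_range_add, ih (by omega), blk_sum r n a q _ (by omega) le_rfl,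
      Finset.sum_range_succ]

lemma flat_sum_le (α : ℝ) {ν : ℕ} {ι : Type*} (s : Finset ι)
    (f : ι → Matrix (Fin (2 ^ ν)) (Fin (2 ^ ν)) ℂ) :
    flatNorm α (∑ i ∈ s, f i) ≤ ∑ i ∈ s, flatNorm α (f i) := by
  unfold flatNorm; rw [Finset.mul_sum]; exact tn_sum_le _ _

lemma opNorm_nonneg' {N : ℕ} (x : Matrix (Fin N) (Fin N) ℂ) : 0 ≤ opNorm x := norm_nonneg _

lemma main_one (α : ℝ) (r : ℕ → Matrix (Fin 2) (Fin 2) ℂ)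
    (hr : ∀ j < 4, ∀ k < 4, rho1 α (r j * (r k)ᴴ) = if j = k then 1 else 0)
    (m : ℕ) (hm : m ≤ 3) (a : ℕ → ℂ) :
    flat2 α (∑ j ∈ Finset.range (m + 1), a j • r j) ≤
        (∑ j ∈ Finset.range 4, opNorm (r j) * flat2 α (r j)) *
          flat2 α (∑ j ∈ Finset.range 4, a j • r j) := by
  set X := flat2 α (∑ j ∈ Finset.range 4, a j • r j) with hX
  have hX0 : 0 ≤ X := tn_nonneg _
  calc flat2 α (∑ j ∈ Finset.range (m + 1), a j • r j)
      ≤ ∑ j ∈ Finset.range (m + 1), ‖a j‖ * flat2 α (r j) := by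
        unfold flat2
        rw [Finset.mul_sum]
        refine (tn_sum_le _ _).trans (Finset.sum_le_sum fun j _ => ?_)
        rw [Matrix.mul_smul]
        exact tn_smul_le _ _
    _ ≤ ∑ j ∈ Finset.range 4, ‖a j‖ * flat2 α (r j) := by
        refine Finset.sum_le_sum_of_subset_of_nonneg ?_ fun j _ _ =>
          mul_nonneg (norm_nonneg _) (tn_nonneg _)
        exact Finset.range_mono (by omega)
    _ ≤ ∑ j ∈ Finset.range 4, opNorm (r j) * flat2 α (r j) * X := by
        refine Finset.sum_le_sum fun j hj => ?_
        have := coeff2_le α r hr a j (Finset.mem_range.1 hj)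
        calc _ ≤ (opNorm (r j) * X) * flat2 α (r j) :=
              mul_le_mul_of_nonneg_right this (tn_nonneg _)
          _ = _ := by ring
    _ = _ := by rw [Finset.sum_mul]

lemma main_two (α : ℝ) (hα0 : 0 < α) (hα : α ≤ 1 / 2)
    (r : ℕ → Matrix (Fin 2) (Fin 2) ℂ)
    (hr : ∀ j < 4, ∀ k < 4, rho1 α (r j * (r k)ᴴ) = if j = k then 1 else 0)
    (n : ℕ) (c : ℝ) (hc : 0 ≤ c)
    (h : ∀ m < 4 ^ (n + 1), ∀ a : ℕ → ℂ,
        flatNorm α (∑ j ∈ Finset.range (m + 1), a j • haar r (n + 1) j) ≤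
          c * flatNorm α (∑ j ∈ Finset.range (4 ^ (n + 1)), a j • haar r (n + 1) j))
    (m : ℕ) (hm : m < 4 ^ (n + 2)) (a : ℕ → ℂ) :
    flatNorm α (∑ j ∈ Finset.range (m + 1), a j • haar r (n + 2) j) ≤
      max (c * opNorm (r 0) ^ 2)
          (opNorm (r 0) ^ 2 + 2 * (opNorm (r 1) ^ 2 + opNorm (r 2) ^ 2 + opNorm (r 3) ^ 2)) *
        flatNorm α (∑ j ∈ Finset.range (4 ^ (n + 2)), a j • haar r (n + 2) j) := by
  have hfull : ∑ j ∈ Finset.range (4 ^ (n + 2)), a j • haar r (n + 2) j =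
      ∑ p ∈ Finset.range 4, kr (blk r n a p (4 ^ (n + 1))) (r p) := by
    rw [← haar_sum_full r n a 4 le_rfl, ← pow_succ]
  set X := flatNorm α (∑ j ∈ Finset.range (4 ^ (n + 2)), a j • haar r (n + 2) j) with hX
  have hX0 : 0 ≤ X := tn_nonneg _
  have hpos : 0 < 4 ^ (n + 1) := by positivity
  obtain ⟨q, hqdef⟩ : ∃ q, q = m / 4 ^ (n + 1) := ⟨_, rfl⟩
  obtain ⟨k, hkdef⟩ : ∃ k, k = m % 4 ^ (n + 1) := ⟨_, rfl⟩
  have hk : k < 4 ^ (n + 1) := by rw [hkdef]; exact Nat.mod_lt _ hpos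
  have hq : q < 4 := by
    rw [hqdef]; apply Nat.div_lt_of_lt_mul; rw [← pow_succ]; exact hm
  have hmk : m + 1 = 4 ^ (n + 1) * q + (k + 1) := by
    rw [hqdef, hkdef, ← add_assoc, Nat.div_add_mod]
  rw [hmk, Finset.sum_range_add, haar_sum_full r n a q hq.le, blk_sum r n a q (k + 1) hq hk]
  have hcoef : ∀ p < 4, flatNorm α (blk r n a p (4 ^ (n + 1))) ≤ opNorm (r p) * X := by
    intro p hp
    rw [hX, hfull]
    exact coeff_le α r hr (fun p => blk r n a p (4 ^ (n + 1))) p hp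
  have hblk : ∀ p < 4, flatNorm α (kr (blk r n a p (4 ^ (n + 1))) (r p)) ≤
      opNorm (r p) ^ 2 * X := by
    intro p hp
    calc _ ≤ flatNorm α (blk r n a p (4 ^ (n + 1))) * opNorm (r p) := flat_kr_le α hα0 hα _ _
      _ ≤ (opNorm (r p) * X) * opNorm (r p) :=
        mul_le_mul_of_nonneg_right (hcoef p hp) (opNorm_nonneg' _)
      _ = _ := by ring
  rcases Nat.eq_zero_or_pos q with hq0 | hq0
  · have h0 : ∀ K, blk r n a 0 K = ∑ k ∈ Finset.range K, a k • haar r (n + 1) k := fun K => by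
      simp [blk]
    have h2 := h k hk a
    rw [← h0, ← h0] at h2
    rw [hq0, Finset.sum_range_zero, zero_add]
    calc _ ≤ flatNorm α (blk r n a 0 (k + 1)) * opNorm (r 0) := flat_kr_le α hα0 hα _ _
      _ ≤ (c * (opNorm (r 0) * X)) * opNorm (r 0) := by
        refine mul_le_mul_of_nonneg_right (h2.trans ?_) (opNorm_nonneg' _)
        exact mul_le_mul_of_nonneg_left (hcoef 0 (by norm_num)) hc
      _ = (c * opNorm (r 0) ^ 2) * X := by ring
      _ ≤ _ := mul_le_mul_of_nonneg_right (le_max_left _ _) hX0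
  · have hlast : flatNorm α (kr (blk r n a q (k + 1)) (r q)) ≤ 2 * (opNorm (r q) ^ 2 * X) := by
      have h1 : flatNorm α (blk r n a q (k + 1)) ≤
          2 * flatNorm α (blk r n a q (4 ^ (n + 1))) := by
        simp only [blk, if_neg hq0.ne']
        exact flat_eUnit_le α (k + 1) (fun k => a (4 ^ (n + 1) * q + k))
      calc _ ≤ flatNorm α (blk r n a q (k + 1)) * opNorm (r q) := flat_kr_le α hα0 hα _ _
        _ ≤ (2 * (opNorm (r q) * X)) * opNorm (r q) := by
          refine mul_le_mul_of_nonneg_right (h1.trans ?_) (opNorm_nonneg' _)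
          exact mul_le_mul_of_nonneg_left (hcoef q hq) (by norm_num)
        _ = _ := by ring
    refine le_trans ?_ (mul_le_mul_of_nonneg_right (le_max_right _ _) hX0)
    refine (flat_add_le α _ _).trans ?_
    refine (add_le_add (flat_sum_le α _ _) hlast).trans ?_
    refine (add_le_add (Finset.sum_le_sum (g := fun p => opNorm (r p) ^ 2 * X) fun p hp => hblk p
      ((Finset.mem_range.1 hp).trans hq)) le_rfl).trans ?_
    have n1 : 0 ≤ opNorm (r 1) ^ 2 * X := by positivity
    have n2 : 0 ≤ opNorm (r 2) ^ 2 * X := by positivity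
    have n3 : 0 ≤ opNorm (r 3) ^ 2 * X := by positivity
    clear hlast hqdef hmk
    interval_cases q <;> simp only [Finset.sum_range_succ, Finset.sum_range_zero] <;> nlinarith

end helpers

/-- estimates for the right Haar system basis constants:
`c_{1,♭} ≤ Σ ‖r_j‖‖r_j‖_♭` and `c_{ν+1,♭} ≤ max{c‖r_0‖², ‖r_0‖² + 2Σ_{q=1}^3 ‖r_q‖²}`. -/
theorem haar_basis_constants_flat
    (α : ℝ) (hα0 : 0 < α) (hα : α ≤ 1 / 2)
    (r : ℕ → Matrix (Fin 2) (Fin 2) ℂ)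
    (hr : ∀ j < 4, ∀ k < 4, rho1 α (r j * (r k)ᴴ) = if j = k then 1 else 0) :
    (∀ m ≤ 3, ∀ a : ℕ → ℂ,
      flat2 α (∑ j ∈ Finset.range (m + 1), a j • r j) ≤
        (∑ j ∈ Finset.range 4, opNorm (r j) * flat2 α (r j)) *
          flat2 α (∑ j ∈ Finset.range 4, a j • r j)) ∧
    (∀ ν, 1 ≤ ν → ∀ c : ℝ, 0 ≤ c →
      (∀ m < 4 ^ ν, ∀ a : ℕ → ℂ,
        flatNorm α (∑ j ∈ Finset.range (m + 1), a j • haar r ν j) ≤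
          c * flatNorm α (∑ j ∈ Finset.range (4 ^ ν), a j • haar r ν j)) →
      ∀ m < 4 ^ (ν + 1), ∀ a : ℕ → ℂ,
        flatNorm α (∑ j ∈ Finset.range (m + 1), a j • haar r (ν + 1) j) ≤
          max (c * opNorm (r 0) ^ 2)
              (opNorm (r 0) ^ 2 + 2 * (opNorm (r 1) ^ 2 + opNorm (r 2) ^ 2 + opNorm (r 3) ^ 2)) *
            flatNorm α (∑ j ∈ Finset.range (4 ^ (ν + 1)), a j • haar r (ν + 1) j)) := by
  refine ⟨fun m hm a => main_one α r hr m hm a, fun ν hν c hc h m hm a => ?_⟩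
  obtain ⟨n, rfl⟩ : ∃ n, ν = n + 1 := ⟨ν - 1, by omega⟩
  exact main_two α hα0 hα r hr n c hc h m hm a

end
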